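/- Let U ∈ ℝ^{p×r} have orthonormal columns, let Δ ∈ ℝ^{p×r} be arbitrary, write P = UUᵀ, and set C_Δ = I_r + Δᵀ(I − P)Δ. Then: (i) C_Δ is symmetric positive definite, its positive-definite square root C_Δ^{1/2} and inverse square root C_Δ^{−1/2} exist, and the matrix Ū = (U + (I − P)Δ) C_Δ^{−1/2} has orthonormal columns; (ii) ‖C_Δ^{1/2} − I_r‖ ≤ ‖Δᵀ(I − P)Δ‖; (iii) if additionally ‖(I − P)Δ‖² ≤ 1/2, then ‖C_Δ^{−1/2} − I_r‖ ≤ 2‖Δᵀ(I − P)Δ‖ and ‖Ū‖_{2,∞} ≤ ( ‖U‖_{2,∞} + ‖(I − P)Δ‖_{2,∞} ) ( 1 + 2‖(I − P)Δ‖² ). -/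

import Mathlib

open MeasureTheory ProbabilityTheory Matrix
open scoped ENNReal NNReal Kronecker

noncomputable section

/-- The Euclidean norm of a finitely indexed real vector. -/
def euclNorm {n : Type*} [Fintype n] (x : n → ℝ) : ℝ :=
  Real.sqrt (∑ i, x i ^ 2)

/-- `‖M‖_{2,∞}`, the largest row `ℓ₂`-norm of a matrix. -/
def norm2inf {m n : Type*} [Fintype m] [Fintype n] (M : Matrix m n ℝ) : ℝ :=
  ⨆ i, euclNorm fun j => M i j

/-- The spectral norm (largest singular value) of a real matrix, realized as the
`ℓ₂ → ℓ₂` operator norm. -/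
def specNorm {m n : Type*} [Fintype m] [Fintype n] [DecidableEq n] (M : Matrix m n ℝ) : ℝ :=
  ‖LinearMap.toContinuousLinearMap (Matrix.toEuclideanLin M)‖

/-- `sValGe A r c` says that the `r`-th largest singular value of `A` is at least `c`,
expressed through the Courant–Fischer min-max characterization. -/
def sValGe {m n : Type*} [Fintype m] [Fintype n] [DecidableEq n]
    (A : Matrix m n ℝ) (r : ℕ) (c : ℝ) : Prop :=
  ∃ V : Submodule ℝ (EuclideanSpace ℝ n), Module.finrank ℝ V = r ∧
    ∀ x ∈ V, c * ‖x‖ ≤ ‖Matrix.toEuclideanLin A x‖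

/-- The Tucker (mode-wise) product `T ×₁ A₁ ×₂ A₂ ×₃ A₃` of an order-3 tensor with
three matrices. -/
def tuckerProd {n₁ n₂ n₃ q₁ q₂ q₃ : ℕ} (T : Fin n₁ → Fin n₂ → Fin n₃ → ℝ)
    (A₁ : Matrix (Fin q₁) (Fin n₁) ℝ) (A₂ : Matrix (Fin q₂) (Fin n₂) ℝ)
    (A₃ : Matrix (Fin q₃) (Fin n₃) ℝ) : Fin q₁ → Fin q₂ → Fin q₃ → ℝ :=
  fun i j k => ∑ a, ∑ b, ∑ c, T a b c * A₁ i a * A₂ j b * A₃ k c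

/-- Mode-1 matricization; the column pair `(b, c)` corresponds to `(b-1)p₃ + c`. -/
def mat1 {n₁ n₂ n₃ : ℕ} (T : Fin n₁ → Fin n₂ → Fin n₃ → ℝ) :
    Matrix (Fin n₁) (Fin n₂ × Fin n₃) ℝ :=
  Matrix.of fun a bc => T a bc.1 bc.2

/-- Mode-2 matricization; the column pair `(c, a)` corresponds to `(c-1)p₁ + a`. -/
def mat2 {n₁ n₂ n₃ : ℕ} (T : Fin n₁ → Fin n₂ → Fin n₃ → ℝ) :
    Matrix (Fin n₂) (Fin n₃ × Fin n₁) ℝ :=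
  Matrix.of fun b ca => T ca.2 b ca.1

/-- Mode-3 matricization; the column pair `(a, b)` corresponds to `(a-1)p₂ + b`. -/
def mat3 {n₁ n₂ n₃ : ℕ} (T : Fin n₁ → Fin n₂ → Fin n₃ → ℝ) :
    Matrix (Fin n₃) (Fin n₁ × Fin n₂) ℝ :=
  Matrix.of fun c ab => T ab.1 ab.2 c

/-- The law of `T + Z`, where `Z` has independent `N(0, σ_{abc}²)` entries: the product of
Gaussian measures with means `T_{abc}` and variances `σ_{abc}²`. -/
def lawOf {p₁ p₂ p₃ : ℕ} (Tm : Fin p₁ → Fin p₂ → Fin p₃ → ℝ)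
    (sd : Fin p₁ → Fin p₂ → Fin p₃ → ℝ≥0) :
    Measure (Fin p₁ → Fin p₂ → Fin p₃ → ℝ) :=
  Measure.pi fun a => Measure.pi fun b => Measure.pi fun c =>
    gaussianReal (Tm a b c) (sd a b c ^ 2)

/-- Covariance matrix of a vector-valued random variable. -/
def covMatrix {D : Type*} [MeasurableSpace D] (μ : Measure D) {r : ℕ} (f : D → Fin r → ℝ) :
    Matrix (Fin r) (Fin r) ℝ :=
  Matrix.of fun s t =>
    ∫ x, (f x s - ∫ y, f y s ∂μ) * (f x t - ∫ y, f y t ∂μ) ∂μ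

/-- A parameter `θ = (S, U₁, U₂, U₃, (σ_{abc}))` of the tensor denoising model. -/
structure TuckerParam (p₁ p₂ p₃ r₁ r₂ r₃ : ℕ) where
  core : Fin r₁ → Fin r₂ → Fin r₃ → ℝ
  U1 : Matrix (Fin p₁) (Fin r₁) ℝ
  U2 : Matrix (Fin p₂) (Fin r₂) ℝ
  U3 : Matrix (Fin p₃) (Fin r₃) ℝ
  sd : Fin p₁ → Fin p₂ → Fin p₃ → ℝ≥0

/-- The signal tensor `T(θ) = S ×₁ U₁ ×₂ U₂ ×₃ U₃`. -/
def TuckerParam.T {p₁ p₂ p₃ r₁ r₂ r₃ : ℕ} (θ : TuckerParam p₁ p₂ p₃ r₁ r₂ r₃) :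
    Fin p₁ → Fin p₂ → Fin p₃ → ℝ :=
  tuckerProd θ.core θ.U1 θ.U2 θ.U3

/-- `P_θ`, the law of `T(θ) + Z` where `Z` has independent `N(0, σ_{abc}²)` entries. -/
def TuckerParam.law {p₁ p₂ p₃ r₁ r₂ r₃ : ℕ} (θ : TuckerParam p₁ p₂ p₃ r₁ r₂ r₃) :
    Measure (Fin p₁ → Fin p₂ → Fin p₃ → ℝ) :=
  lawOf θ.T θ.sd

/-- Membership in the parameter class `Θ(λ, κ, μ₀, σ, σ_min)`, with absolute constant `C₀`.
The rank/singular-value condition on the matricizations of the core is expressed through the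
equivalent two-sided bound `λ‖x‖ ≤ ‖xᵀ M_k(S)‖ ≤ κλ‖x‖`. -/
def InTheta {p₁ p₂ p₃ r₁ r₂ r₃ : ℕ} (lam kap mu0 sig sigmin C0 : ℝ)
    (θ : TuckerParam p₁ p₂ p₃ r₁ r₂ r₃) : Prop :=
  θ.U1ᵀ * θ.U1 = 1 ∧ θ.U2ᵀ * θ.U2 = 1 ∧ θ.U3ᵀ * θ.U3 = 1 ∧
  norm2inf θ.U1 ≤ mu0 * Real.sqrt ((r₁ : ℝ) / (p₁ : ℝ)) ∧
  norm2inf θ.U2 ≤ mu0 * Real.sqrt ((r₂ : ℝ) / (p₂ : ℝ)) ∧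
  norm2inf θ.U3 ≤ mu0 * Real.sqrt ((r₃ : ℝ) / (p₃ : ℝ)) ∧
  (∀ x : Fin r₁ → ℝ, lam * euclNorm x ≤ euclNorm (Matrix.vecMul x (mat1 θ.core)) ∧
    euclNorm (Matrix.vecMul x (mat1 θ.core)) ≤ kap * lam * euclNorm x) ∧
  (∀ x : Fin r₂ → ℝ, lam * euclNorm x ≤ euclNorm (Matrix.vecMul x (mat2 θ.core)) ∧
    euclNorm (Matrix.vecMul x (mat2 θ.core)) ≤ kap * lam * euclNorm x) ∧
  (∀ x : Fin r₃ → ℝ, lam * euclNorm x ≤ euclNorm (Matrix.vecMul x (mat3 θ.core)) ∧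
    euclNorm (Matrix.vecMul x (mat3 θ.core)) ≤ kap * lam * euclNorm x) ∧
  C0 * kap * ((max r₁ (max r₂ r₃) : ℕ) : ℝ) * Real.sqrt ((max p₁ (max p₂ p₃) : ℕ) : ℝ)
    ≤ lam / sig ∧
  kap ≤ ((min p₁ (min p₂ p₃) : ℕ) : ℝ) ^ ((1 : ℝ) / 4) ∧
  ((max r₁ (max r₂ r₃) : ℕ) : ℝ) ≤ Real.sqrt ((min p₁ (min p₂ p₃) : ℕ) : ℝ) ∧
  ∀ a b c, sigmin ≤ (θ.sd a b c : ℝ) ∧ (θ.sd a b c : ℝ) ≤ sig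


theorem specNorm_nonneg {m n : Type*} [Fintype m] [Fintype n] [DecidableEq n]
    (M : Matrix m n ℝ) : 0 ≤ specNorm M :=
  norm_nonneg _

theorem euclNorm_eq_norm {n : Type*} [Fintype n] (x : n → ℝ) :
    euclNorm x = ‖WithLp.toLp 2 x‖ := by
  simp [euclNorm, EuclideanSpace.norm_eq]

theorem euclNorm_eq_sqrt_dotProduct {n : Type*} [Fintype n] (x : n → ℝ) :
    euclNorm x = Real.sqrt (x ⬝ᵥ x) := by
  simp [euclNorm, dotProduct, sq]

theorem euclNorm_nonneg {n : Type*} [Fintype n] (x : n → ℝ) : 0 ≤ euclNorm x :=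
  Real.sqrt_nonneg _

theorem euclNorm_add_le {n : Type*} [Fintype n] (x y : n → ℝ) :
    euclNorm (x + y) ≤ euclNorm x + euclNorm y := by
  simpa only [euclNorm_eq_norm, WithLp.toLp_add] using
    norm_add_le (WithLp.toLp 2 x) (WithLp.toLp 2 y)

theorem norm2inf_nonneg {m n : Type*} [Fintype m] [Fintype n] (M : Matrix m n ℝ) :
    0 ≤ norm2inf M :=
  Real.iSup_nonneg fun _ => euclNorm_nonneg _

theorem euclNorm_row_le_norm2inf {m n : Type*} [Fintype m] [Fintype n] (M : Matrix m n ℝ)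
    (i : m) : euclNorm (M i) ≤ norm2inf M :=
  le_ciSup (f := fun i => euclNorm (M i)) (Set.finite_range _).bddAbove i

theorem norm2inf_add_le {m n : Type*} [Fintype m] [Fintype n] (M N : Matrix m n ℝ) :
    norm2inf (M + N) ≤ norm2inf M + norm2inf N :=
  Real.iSup_le (fun i => (euclNorm_add_le (M i) (N i)).trans
    (add_le_add (euclNorm_row_le_norm2inf M i) (euclNorm_row_le_norm2inf N i)))
    (add_nonneg (norm2inf_nonneg M) (norm2inf_nonneg N))

/-- Multiplying on the left by a norm-nondecreasing matrix does not decrease the spectral norm. -/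
theorem specNorm_le_specNorm_mul {l m n : Type*} [Fintype l] [Fintype m] [Fintype n]
    [DecidableEq n] {A : Matrix l m ℝ} (hA : ∀ x, euclNorm x ≤ euclNorm (A *ᵥ x))
    (M : Matrix m n ℝ) : specNorm M ≤ specNorm (A * M) := by
  refine ContinuousLinearMap.opNorm_le_bound _ (specNorm_nonneg _) fun x => ?_
  refine le_trans ?_ (ContinuousLinearMap.le_opNorm
    (LinearMap.toContinuousLinearMap (Matrix.toEuclideanLin (A * M))) x)
  have h := hA (M *ᵥ x.ofLp)
  rw [mulVec_mulVec, euclNorm_eq_norm, euclNorm_eq_norm] at h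
  exact h

/-- Multiplying on the right by a matrix whose transpose is norm-nondecreasing does not decrease
the largest row norm. -/
theorem norm2inf_le_norm2inf_mul {l m n : Type*} [Fintype l] [Fintype m] [Fintype n]
    {A : Matrix m n ℝ} (hA : ∀ x, euclNorm x ≤ euclNorm (Aᵀ *ᵥ x))
    (M : Matrix l m ℝ) : norm2inf M ≤ norm2inf (M * A) := by
  refine Real.iSup_le (fun i => ?_) (norm2inf_nonneg _)
  refine (hA (M i)).trans ?_
  rw [mulVec_transpose]
  exact euclNorm_row_le_norm2inf (M * A) i

theorem euclNorm_le_euclNorm_mulVec_of_mul_self {n : Type*} [Fintype n] [DecidableEq n]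
    {S B : Matrix n n ℝ} (hS : Sᵀ = S) (hB : B.PosSemidef) (h : S * S = 1 + B) (x : n → ℝ) :
    euclNorm x ≤ euclNorm (S *ᵥ x) := by
  rw [euclNorm_eq_sqrt_dotProduct, euclNorm_eq_sqrt_dotProduct]
  refine Real.sqrt_le_sqrt ?_
  have hx := hB.dotProduct_mulVec_nonneg x
  rw [star_trivial] at hx
  rw [dotProduct_mulVec, ← mulVec_transpose, hS, mulVec_mulVec, h, add_mulVec, one_mulVec,
    add_dotProduct, dotProduct_comm (B *ᵥ x)]
  linarith

theorem euclNorm_le_euclNorm_add_one_mulVec {n : Type*} [Fintype n] [DecidableEq n]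
    {S : Matrix n n ℝ} (hS : S.PosSemidef) (x : n → ℝ) :
    euclNorm x ≤ euclNorm ((S + 1) *ᵥ x) := by
  rw [euclNorm_eq_sqrt_dotProduct, euclNorm_eq_sqrt_dotProduct]
  refine Real.sqrt_le_sqrt ?_
  have hx := hS.dotProduct_mulVec_nonneg x
  have hSx : 0 ≤ (S *ᵥ x) ⬝ᵥ (S *ᵥ x) := by
    simpa using dotProduct_star_self_nonneg (S *ᵥ x)
  rw [star_trivial] at hx
  rw [add_mulVec, one_mulVec, add_dotProduct, dotProduct_add, dotProduct_add,
    dotProduct_comm (S *ᵥ x) x]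
  linarith

open scoped MatrixOrder Matrix.Norms.L2Operator in
theorem Matrix.PosDef.exists_posDef_mul_self {n : Type*} [Fintype n] [DecidableEq n]
    {A : Matrix n n ℝ} (hA : A.PosDef) : ∃ S : Matrix n n ℝ, S.PosDef ∧ S * S = A := by
  have h : CFC.sqrt A * CFC.sqrt A = A := CFC.sqrt_mul_sqrt_self A hA.posSemidef.nonneg
  refine ⟨CFC.sqrt A, ?_, h⟩
  have hS : (CFC.sqrt A).PosSemidef := (CFC.sqrt_nonneg A).posSemidef
  rw [hS.posDef_iff_det_ne_zero]
  intro h0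
  have := hA.det_pos
  rw [← h, det_mul, h0] at this
  simp at this

/-- properties of the normalization matrix `C_Δ = I + Δᵀ(I-P)Δ`, its
positive-definite square root `S`, and the renormalized frame `Ū = (U + (I-P)Δ)S⁻¹`. -/
theorem stmt14 (p r : ℕ) (U Dm : Matrix (Fin p) (Fin r) ℝ) (hU : Uᵀ * U = 1)
    (Q : Matrix (Fin p) (Fin p) ℝ) (hQ : Q = 1 - U * Uᵀ)
    (Cd : Matrix (Fin r) (Fin r) ℝ) (hC : Cd = 1 + Dmᵀ * Q * Dm) :
    Cd.PosDef ∧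
    ∃ S : Matrix (Fin r) (Fin r) ℝ, S.PosDef ∧ S * S = Cd ∧ IsUnit S.det ∧
      ((U + Q * Dm) * S⁻¹)ᵀ * ((U + Q * Dm) * S⁻¹) = 1 ∧
      specNorm (S - 1) ≤ specNorm (Dmᵀ * Q * Dm) ∧
      (specNorm (Q * Dm) ^ 2 ≤ 1 / 2 →
        specNorm (S⁻¹ - 1) ≤ 2 * specNorm (Dmᵀ * Q * Dm) ∧
          norm2inf ((U + Q * Dm) * S⁻¹) ≤
            (norm2inf U + norm2inf (Q * Dm)) * (1 + 2 * specNorm (Q * Dm) ^ 2)) := by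
  have hQt : Qᵀ = Q := by simp [hQ, transpose_sub, transpose_mul]
  have hUQ : Uᵀ * Q = 0 := by
    rw [hQ, Matrix.mul_sub, Matrix.mul_one, ← Matrix.mul_assoc, hU, Matrix.one_mul, sub_self]
  have hQU : Q * U = 0 := by
    simpa [transpose_mul, hQt] using congrArg transpose hUQ
  have hQQ : Q * Q = Q := by
    conv_lhs => rw [hQ, Matrix.sub_mul, Matrix.one_mul, Matrix.mul_assoc, ← hQ, hUQ]
    simp
  have hB : Dmᵀ * Q * Dm = (Q * Dm)ᵀ * (Q * Dm) := by
    rw [transpose_mul, hQt, Matrix.mul_assoc, Matrix.mul_assoc, ← Matrix.mul_assoc Q Q, hQQ]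
  have hBpos : (Dmᵀ * Q * Dm).PosSemidef := by
    rw [hB, ← conjTranspose_eq_transpose_of_trivial]
    exact posSemidef_conjTranspose_mul_self _
  have hCpos : Cd.PosDef := hC ▸ PosDef.one.add_posSemidef hBpos
  obtain ⟨S, hS, hSS⟩ := hCpos.exists_posDef_mul_self
  have hSt : Sᵀ = S := by
    rw [← conjTranspose_eq_transpose_of_trivial]
    exact hS.isHermitian
  have hdet : IsUnit S.det := hS.det_pos.ne'.isUnit
  have hexp := euclNorm_le_euclNorm_mulVec_of_mul_self hSt hBpos (hSS.trans hC)
  have hgram : (U + Q * Dm)ᵀ * (U + Q * Dm) = S * S := by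
    rw [hSS, hC, hB, transpose_add, Matrix.add_mul, Matrix.mul_add, Matrix.mul_add, hU,
      ← Matrix.mul_assoc Uᵀ, hUQ, transpose_mul, hQt, Matrix.mul_assoc Dmᵀ Q U, hQU]
    simp
  have hsub : specNorm (S - 1) ≤ specNorm (Dmᵀ * Q * Dm) := by
    have h : (S + 1) * (S - 1) = Dmᵀ * Q * Dm := by
      rw [Matrix.add_mul, Matrix.mul_sub, hSS, hC]
      simp
    exact h ▸ specNorm_le_specNorm_mul (euclNorm_le_euclNorm_add_one_mulVec hS.posSemidef) _
  refine ⟨hCpos, S, hS, hSS, hdet, ?_, hsub, fun _ => ⟨?_, ?_⟩⟩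
  · rw [transpose_mul, Matrix.mul_assoc, ← Matrix.mul_assoc _ _ S⁻¹, hgram, transpose_nonsing_inv,
      hSt, Matrix.mul_assoc S, mul_nonsing_inv _ hdet, Matrix.mul_one, nonsing_inv_mul _ hdet]
  · have h : S * (S⁻¹ - 1) = -(S - 1) := by
      rw [Matrix.mul_sub, mul_nonsing_inv _ hdet, Matrix.mul_one, neg_sub]
    have hneg : specNorm (-(S - 1)) = specNorm (S - 1) := by
      simp only [specNorm, map_neg, norm_neg]
    have hle := specNorm_le_specNorm_mul hexp (S⁻¹ - 1)
    rw [h, hneg] at hle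
    linarith [specNorm_nonneg (Dmᵀ * Q * Dm)]
  · have hle := norm2inf_le_norm2inf_mul (A := S) (by rwa [hSt]) ((U + Q * Dm) * S⁻¹)
    rw [Matrix.mul_assoc, nonsing_inv_mul _ hdet, Matrix.mul_one] at hle
    refine (hle.trans (norm2inf_add_le _ _)).trans (le_mul_of_one_le_right
      (add_nonneg (norm2inf_nonneg _) (norm2inf_nonneg _)) ?_)
    linarith [sq_nonneg (specNorm (Q * Dm))]

end
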